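/- arXiv:2211.03354 — 5 statements merged into one kernel-verified Lean document; each statement's English description precedes it below -/
import Mathlib

section
/- Let m, n ≥ 1, let λ be a weight of type (m,n), let C be a circle of λ, and let k be the number of circles of λ that are strictly enclosed in C. Then the height of the weight s_C(λ) satisfies |s_C(λ)| = |λ| + 2k + 1. In particular, any two weights joined by an edge of Γ_m^n have heights of opposite parity. -/
open scoped Classical

namespace Kh

abbrev Wt (N : ℕ) := Fin N → Bool

variable {N : ℕ}

/-- A weight of type `(m,n)`: `m` downs (`true`) and `n` ups (`false`). -/
def IsWeight (m n : ℕ) (l : Wt N) : Prop :=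
  {i : Fin N | l i = true}.ncard = m ∧ {i : Fin N | l i = false}.ncard = n

/-- The height of a weight: sum over downs of the number of ups to the left. -/
noncomputable def height (l : Wt N) : ℕ :=
  ∑ i : Fin N, if l i = true then {j : Fin N | j < i ∧ l j = false}.ncard else 0

/-- Number of positions `t` with `i < t ≤ j` and value `b`. -/
noncomputable def cnt (l : Wt N) (b : Bool) (i j : Fin N) : ℕ :=
  {t : Fin N | i < t ∧ t ≤ j ∧ l t = b}.ncard

/-- `(i,j)` is a matched pair ("circle") of the standard non-crossing bracket matching
of `l` (reading `true` = ↓ as an opening bracket and `false` = ↑ as a closing bracket):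
`l i = ↓`, `l j = ↑`, the segment strictly between `i` and `j` is balanced and every
prefix of it has at least as many ↓'s as ↑'s. -/
def IsCircle (l : Wt N) (i j : Fin N) : Prop :=
  i < j ∧ l i = true ∧ l j = false ∧
    cnt l true i j + 1 = cnt l false i j ∧
    ∀ k : Fin N, i < k → k < j → cnt l false i k ≤ cnt l true i k

/-- `s_C(λ)`: exchange the values of `l` at the two positions of the circle `C = (i,j)`. -/
def swapC (l : Wt N) (i j : Fin N) : Wt N :=
  fun t => if t = i then l j else if t = j then l i else l t

/-- The circle `(i,j)` encloses the circle `(i',j')`. -/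
def Encloses (i j i' j' : Fin N) : Prop := i < i' ∧ j' < j

/-- The circle `(i,j)` lies to the left of the circle `(i',j')`. -/
def LeftOf (i j i' j' : Fin N) : Prop := j < i'

/-- The position `p` is unmatched in `l`. -/
def Unmatched (l : Wt N) (p : Fin N) : Prop :=
  ∀ q : Fin N, ¬ IsCircle l p q ∧ ¬ IsCircle l q p

/-- `def(λ)`: the number of circles of `l`. -/
noncomputable def defect (l : Wt N) : ℕ :=
  {p : Fin N × Fin N | IsCircle l p.1 p.2}.ncard

/-- One step up in the graph `Γ_m^n`: `m' = s_C(l)` for some circle `C` of `l`. -/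
def GammaStep (l m' : Wt N) : Prop :=
  ∃ i j : Fin N, IsCircle l i j ∧ m' = swapC l i j

/-- Adjacency in the graph `Γ_m^n`. -/
def GammaAdj (l m' : Wt N) : Prop := GammaStep l m' ∨ GammaStep m' l

/-- The order embedding `Fin N → Fin (N+2)` skipping the two positions `i`, `i+1`;
composing a weight with it deletes these two positions. -/
def skip2 (i : ℕ) {N : ℕ} (t : Fin N) : Fin (N + 2) :=
  if (t : ℕ) < i then Fin.castLE (Nat.le_add_right N 2) t
  else ⟨(t : ℕ) + 2, Nat.add_lt_add_right t.isLt 2⟩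

end Kh

namespace Kh

lemma cnt_self {N : ℕ} (l : Wt N) (b : Bool) (i : Fin N) : cnt l b i i = 0 := by
  unfold cnt
  rw [Set.ncard_eq_zero]
  ext t
  simp only [Set.mem_setOf_eq, Set.mem_empty_iff_false, iff_false]
  intro h
  exact absurd h.1 (not_lt.mpr h.2.1)

lemma cnt_add {N : ℕ} (l : Wt N) (b : Bool) (i p k : Fin N) (h1 : i ≤ p) (h2 : p ≤ k) :
    cnt l b i k = cnt l b i p + cnt l b p k := by
  unfold cnt
  rw [← Set.ncard_union_eq]
  · congr 1
    ext t
    simp only [Set.mem_setOf_eq, Set.mem_union]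
    constructor
    · rintro ⟨h, h', h''⟩
      rcases le_or_gt t p with hp | hp
      · exact Or.inl ⟨h, hp, h''⟩
      · exact Or.inr ⟨hp, h', h''⟩
    · rintro (⟨h, h', h''⟩ | ⟨h, h', h''⟩)
      · exact ⟨h, h'.trans h2, h''⟩
      · exact ⟨h1.trans_lt h, h', h''⟩
  · rw [Set.disjoint_left]
    rintro t ⟨_, h, _⟩ ⟨h', _, _⟩
    exact absurd h' (not_lt.mpr h)

lemma cnt_succ {N : ℕ} (l : Wt N) (b : Bool) (p k : Fin N) (h : p.val + 1 = k.val) :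
    cnt l b p k = if l k = b then 1 else 0 := by
  unfold cnt
  have key : ∀ t : Fin N, (p < t ∧ t ≤ k) ↔ t = k := by
    intro t
    rw [Fin.lt_def, Fin.le_def, Fin.ext_iff]
    omega
  split_ifs with hb
  · rw [Set.ncard_eq_one]
    refine ⟨k, ?_⟩
    ext t
    simp only [Set.mem_setOf_eq, Set.mem_singleton_iff, ← and_assoc, key]
    constructor
    · exact fun h => h.1
    · rintro rfl
      exact ⟨rfl, hb⟩
  · rw [Set.ncard_eq_zero]
    ext t
    simp only [Set.mem_setOf_eq, ← and_assoc, key, Set.mem_empty_iff_false, iff_false]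
    rintro ⟨rfl, hlt⟩
    exact hb hlt

lemma cnt_step {N : ℕ} (l : Wt N) (b : Bool) (i k : Fin N) (h : i < k) :
    ∃ p : Fin N, i ≤ p ∧ p < k ∧ ∀ b, cnt l b i k = cnt l b i p + if l k = b then 1 else 0 := by
  have h' := Fin.lt_def.mp h
  refine ⟨⟨k.val - 1, by omega⟩, ?_, ?_, ?_⟩
  · rw [Fin.le_def]; simp; omega
  · rw [Fin.lt_def]; simp; omega
  · intro b
    rw [← cnt_succ l b ⟨k.val - 1, by omega⟩ k (by simp; omega)]
    apply cnt_add
    · rw [Fin.le_def]; simp; omega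
    · rw [Fin.le_def]; simp

lemma cnt_total {N : ℕ} (l : Wt N) (i j : Fin N) :
    cnt l true i j + cnt l false i j = j.val - i.val := by
  unfold cnt
  rw [← Set.ncard_union_eq]
  · rw [← Fin.card_Ioc, ← Set.ncard_coe_finset]
    congr 1
    ext t
    simp only [Set.mem_union, Set.mem_setOf_eq, Finset.coe_Ioc, Set.mem_Ioc]
    cases l t <;> simp
  · rw [Set.disjoint_left]
    rintro t ⟨_, _, h⟩ ⟨_, _, h'⟩
    rw [h] at h'
    exact absurd h' (by simp)

lemma circle_unique {N : ℕ} (l : Wt N) (i j j' : Fin N) (h : IsCircle l i j)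
    (h' : IsCircle l i j') : j = j' := by
  obtain ⟨a1, _, _, a4, a5⟩ := h
  obtain ⟨b1, _, _, b4, b5⟩ := h'
  rcases lt_trichotomy j j' with hl | hl | hl
  · have := b5 j a1 hl
    omega
  · exact hl
  · have := a5 j' b1 hl
    omega

lemma exists_circle {N : ℕ} (l : Wt N) (i j t : Fin N) (h : IsCircle l i j)
    (h1 : i < t) (h2 : t < j) (ht : l t = true) : ∃ k, IsCircle l t k ∧ k < j := by
  obtain ⟨_, _, _, a4, a5⟩ := h
  have e1 := cnt_add l true i t j h1.le h2.le
  have e2 := cnt_add l false i t j h1.le h2.le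
  have e3 := a5 t h1 h2
  have hex : ∃ k : Fin N, t < k ∧ cnt l true t k < cnt l false t k := ⟨j, h2, by omega⟩
  obtain ⟨k, ⟨hk1, hk2⟩, hmin⟩ :=
    WellFounded.has_min (wellFounded_lt (α := Fin N))
      {k : Fin N | t < k ∧ cnt l true t k < cnt l false t k} hex
  have hmin' : ∀ q, t < q → q < k → cnt l false t q ≤ cnt l true t q := by
    intro q hq hqk
    by_contra hc
    exact hmin q ⟨hq, not_le.mp hc⟩ hqk
  have hkj : k ≤ j := by
    by_contra hc
    exact hmin j ⟨h2, by omega⟩ (not_le.mp hc)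
  obtain ⟨p, hp1, hp2, hp3⟩ := cnt_step l true t k hk1
  have hpc : cnt l false t p ≤ cnt l true t p := by
    rcases eq_or_lt_of_le hp1 with he | hl
    · rw [← he, cnt_self, cnt_self]
    · exact hmin' p hl hp2
  have f1 := hp3 true
  have f2 := hp3 false
  have hlk : l k = false := by
    cases hb : l k
    · rfl
    · simp [hb] at f1 f2
      omega
  simp [hlk] at f1 f2
  refine ⟨k, ⟨hk1, ht, hlk, by omega, hmin'⟩, ?_⟩
  refine lt_of_le_of_ne hkj ?_
  rintro rfl
  obtain ⟨q, hq1, hq2, hq3⟩ := cnt_step l true i t h1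
  have g1 := hq3 true
  have g2 := hq3 false
  simp [ht] at g1 g2
  rcases eq_or_lt_of_le hq1 with he | hl
  · subst he
    rw [cnt_self] at g1 g2
    omega
  · have := a5 q hl (hq2.trans h2)
    omega

lemma enclosed_card {N : ℕ} (l : Wt N) (i j : Fin N) (h : IsCircle l i j) :
    {p : Fin N × Fin N | IsCircle l p.1 p.2 ∧ Encloses i j p.1 p.2}.ncard = cnt l true i j := by
  unfold cnt
  have himg : {t : Fin N | i < t ∧ t ≤ j ∧ l t = true} =
      Prod.fst '' {p : Fin N × Fin N | IsCircle l p.1 p.2 ∧ Encloses i j p.1 p.2} := by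
    ext t
    simp only [Set.mem_setOf_eq, Set.mem_image, Prod.exists, exists_and_right, exists_eq_right]
    constructor
    · rintro ⟨h1, h2, h3⟩
      have hne : t ≠ j := by
        rintro rfl
        rw [h.2.2.1] at h3
        exact absurd h3 (by simp)
      obtain ⟨k, hk, hkj⟩ := exists_circle l i j t h h1 (lt_of_le_of_ne h2 hne) h3
      exact ⟨k, hk, h1, hkj⟩
    · rintro ⟨k, hk, h1, hkj⟩
      exact ⟨h1, (hk.1.trans hkj).le, hk.2.1⟩
  rw [himg, Set.ncard_image_of_injOn]
  rintro ⟨a, b⟩ ⟨h1, _⟩ ⟨a', b'⟩ ⟨h2, _⟩ hab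
  simp only at hab h1 h2
  subst hab
  rw [circle_unique l a b b' h1 h2]

lemma sum_below {N : ℕ} (S : Finset (Fin N)) :
    ∑ i ∈ S, (S.filter (· < i)).card = S.card.choose 2 := by
  induction S using Finset.induction_on_max with
  | empty => simp
  | insert a s hs ih =>
    have ha : a ∉ s := fun h => lt_irrefl _ (hs a h)
    rw [Finset.sum_insert ha, Finset.card_insert_of_notMem ha, Nat.choose_succ_succ' _ 1, ← ih,
      Nat.choose_one_right]
    congr 1
    · congr 1
      ext t
      simp only [Finset.mem_filter, Finset.mem_insert]
      constructor
      · rintro ⟨rfl | h, h'⟩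
        · exact absurd h' (lt_irrefl _)
        · exact h
      · exact fun h => ⟨Or.inr h, hs t h⟩
    · apply Finset.sum_congr rfl
      intro x hx
      rw [Finset.filter_insert, if_neg (not_lt.mpr (hs x hx).le)]

lemma height_add {N : ℕ} (l : Wt N) :
    height l + (Finset.univ.filter (fun i => l i = true)).card.choose 2
      = ∑ i : Fin N, if l i = true then i.val else 0 := by
  rw [← sum_below]
  unfold height
  rw [← Finset.sum_filter, ← Finset.sum_filter, ← Finset.sum_add_distrib]
  apply Finset.sum_congr rfl
  intro i _
  rw [← Set.ncard_coe_finset, ← Set.ncard_union_eq]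
  · have : (i : ℕ) = (Finset.Iio i).card := by simp
    rw [this, ← Set.ncard_coe_finset]
    congr 1
    ext t
    simp only [Set.mem_union, Set.mem_setOf_eq, Finset.coe_filter, Finset.mem_filter,
      Finset.mem_univ, true_and, Finset.coe_Iio, Set.mem_Iio]
    cases l t <;> simp
  · rw [Set.disjoint_left]
    rintro t ⟨_, h⟩ h'
    simp [h] at h'

lemma sum_swapC {N : ℕ} (l : Wt N) (i j : Fin N) (hij : i < j) (hi : l i = true)
    (hj : l j = false) (f : Fin N → ℕ) :
    (∑ t : Fin N, if swapC l i j t = true then f t else 0) + f i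
      = (∑ t : Fin N, if l t = true then f t else 0) + f j := by
  have e1 : f i = ∑ t : Fin N, if t = i then f t else 0 := by simp
  have e2 : f j = ∑ t : Fin N, if t = j then f t else 0 := by simp
  rw [e1, e2, ← Finset.sum_add_distrib, ← Finset.sum_add_distrib]
  apply Finset.sum_congr rfl
  intro t _
  unfold swapC
  by_cases h1 : t = i
  · subst h1
    simp [hi, hj, hij.ne]
  · by_cases h2 : t = j
    · subst h2
      simp [hi, hj, hij.ne']
    · simp [h1, h2]

lemma height_swapC {N : ℕ} (l : Wt N) (i j : Fin N) (h : IsCircle l i j) :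
    height (swapC l i j) = height l +
      2 * {p : Fin N × Fin N | IsCircle l p.1 p.2 ∧ Encloses i j p.1 p.2}.ncard + 1 := by
  rw [enclosed_card l i j h]
  have a1 := height_add l
  have a2 := height_add (swapC l i j)
  have a3 := sum_swapC l i j h.1 h.2.1 h.2.2.1 (fun t => t.val)
  have a4 := sum_swapC l i j h.1 h.2.1 h.2.2.1 (fun _ => 1)
  rw [← Finset.card_filter, ← Finset.card_filter] at a4
  have a5 := Nat.add_right_cancel a4
  rw [a5] at a2
  have a6 := cnt_total l i j
  have a7 := h.2.2.2.1
  have a8 := Fin.lt_def.mp h.1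
  omega

end Kh

namespace Kh

/-- Flipping a circle `C = (i,j)` of a weight raises the height by
`2k+1`, where `k` is the number of circles strictly enclosed in `C`; in particular
any two weights joined by an edge of `Γ_m^n` have heights of opposite parity. -/
theorem statement0 (m n : ℕ) (hm : 1 ≤ m) (hn : 1 ≤ n) {N : ℕ} (hN : N = m + n) :
    (∀ (la : Wt N), IsWeight m n la → ∀ i j : Fin N, IsCircle la i j →
      height (swapC la i j) =
        height la +
          2 * {p : Fin N × Fin N | IsCircle la p.1 p.2 ∧ Encloses i j p.1 p.2}.ncard + 1) ∧
    (∀ la mu : Wt N, IsWeight m n la → IsWeight m n mu → GammaAdj la mu →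
      height la % 2 ≠ height mu % 2) := by
  constructor
  · intro la _ i j h
    exact height_swapC la i j h
  · rintro la mu _ _ (⟨i, j, h, rfl⟩ | ⟨i, j, h, rfl⟩)
    · have := height_swapC la i j h
      omega
    · have := height_swapC mu i j h
      omega

end Kh
end

section
/- For all m, n ≥ 1 the graph Γ_m^n is bipartite with respect to the partition of Λ_m^n into weights of even height and weights of odd height. More precisely, for every walk of length ℓ in Γ_m^n from a weight λ to a weight μ one has |λ| ≡ |μ| + ℓ (mod 2); in particular, walks of even length connect weights whose heights have the same parity, and walks of odd length connect weights whose heights have opposite parity. -/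
open scoped Classical

namespace Kh

/-- Number of pairs of downs. -/
noncomputable def pairs {N : ℕ} (l : Wt N) : ℕ :=
  ∑ i : Fin N, if l i = true then (Finset.univ.filter (fun j : Fin N => j < i ∧ l j = true)).card else 0

noncomputable def posSum {N : ℕ} (l : Wt N) : ℕ :=
  ∑ i : Fin N, if l i = true then (i : ℕ) else 0

theorem height_add_pairs {N : ℕ} (l : Wt N) : height l + pairs l = posSum l := by
  unfold height pairs posSum
  rw [← Finset.sum_add_distrib]
  apply Finset.sum_congr rfl
  intro i _
  by_cases h : l i = true
  · simp only [h, if_true]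
    rw [Set.ncard_eq_toFinset_card']
    have h1 : (Finset.univ.filter (fun j : Fin N => j < i)).card = (i : ℕ) := by
      have : (Finset.univ.filter (fun j : Fin N => j < i)) = Finset.Iio i := by
        ext; simp
      rw [this, Fin.card_Iio]
    rw [← h1, ← Finset.card_union_of_disjoint]
    · congr 1
      ext j
      cases hj : l j <;> simp [hj]
    · rw [Finset.disjoint_left]
      intro j
      cases hj : l j <;> simp [hj]
  · simp [h]

theorem pairs_eq {N : ℕ} (l : Wt N) (m : ℕ) (h : {i : Fin N | l i = true}.ncard = m) :
    2 * pairs l + m = m * m := by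
  have hm : m = ∑ i : Fin N, if l i = true then 1 else 0 := by
    rw [← h, Set.ncard_eq_toFinset_card', ← Finset.card_filter]
    congr 1
    ext; simp
  have h1 : pairs l = ∑ i : Fin N, ∑ j : Fin N, if j < i ∧ l j = true ∧ l i = true then 1 else 0 := by
    unfold pairs
    apply Finset.sum_congr rfl
    intro i _
    by_cases hi : l i = true
    · simp only [hi, if_true, and_true, Finset.card_filter]
    · simp [hi]
  have h2 : pairs l = ∑ i : Fin N, ∑ j : Fin N, if i < j ∧ l j = true ∧ l i = true then 1 else 0 := by
    rw [h1, Finset.sum_comm]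
    apply Finset.sum_congr rfl
    intro i _
    apply Finset.sum_congr rfl
    intro j _
    congr 1
    rw [and_comm (a := l i = true)]
  have h3 : m = ∑ i : Fin N, ∑ j : Fin N, if i = j ∧ l i = true then 1 else 0 := by
    rw [hm]
    apply Finset.sum_congr rfl
    intro i _
    by_cases hi : l i = true <;> simp [hi]
  have h4 : m * m = ∑ i : Fin N, ∑ j : Fin N, if l j = true ∧ l i = true then 1 else 0 := by
    conv_lhs => rw [hm]
    rw [Finset.sum_mul_sum]
    apply Finset.sum_congr rfl
    intro i _
    apply Finset.sum_congr rfl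
    intro j _
    by_cases hi : l i = true <;> by_cases hj : l j = true <;> simp [hi, hj]
  have h5 : pairs l + pairs l + m = m * m := by
    rw [h4]
    conv_lhs => rw [h3]
    nth_rewrite 1 [h1]
    rw [h2, ← Finset.sum_add_distrib, ← Finset.sum_add_distrib]
    apply Finset.sum_congr rfl
    intro i _
    rw [← Finset.sum_add_distrib, ← Finset.sum_add_distrib]
    apply Finset.sum_congr rfl
    intro j _
    rcases lt_trichotomy i j with hij | hij | hij
    · simp [hij, hij.ne, hij.le, not_lt.mpr hij.le]
    · subst hij; simp
    · simp [hij, hij.ne', hij.le, not_lt.mpr hij.le]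
  omega

theorem posSum_swap {N : ℕ} (l : Wt N) (i j : Fin N) (hij : i < j) (hi : l i = true)
    (hj : l j = false) : posSum (swapC l i j) + i = posSum l + j := by
  have e : ∀ k : Fin N, (k : ℕ) = ∑ t : Fin N, if t = k then (k : ℕ) else 0 := by
    intro k; simp
  unfold posSum
  rw [e i, e j, ← Finset.sum_add_distrib, ← Finset.sum_add_distrib]
  apply Finset.sum_congr rfl
  intro t _
  unfold swapC
  by_cases h1 : t = i
  · subst h1
    simp [hij.ne, hi, hj]
  · by_cases h2 : t = j
    · subst h2
      simp [h1, hi, hj]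
    · simp [h1, h2]

theorem cnt_add_s1 {N : ℕ} (l : Wt N) (i j : Fin N) : cnt l true i j + cnt l false i j = (j : ℕ) - i := by
  unfold cnt
  rw [Set.ncard_eq_toFinset_card', Set.ncard_eq_toFinset_card', ← Fin.card_Ioc,
    ← Finset.card_union_of_disjoint]
  · congr 1
    ext t
    cases ht : l t <;> simp [ht]
  · rw [Finset.disjoint_left]
    intro t
    cases ht : l t <;> simp [ht]

theorem step_parity {N : ℕ} (m n : ℕ) (la mu : Wt N) (h1 : IsWeight m n la) (h2 : IsWeight m n mu)
    (h : GammaStep la mu) : height la % 2 ≠ height mu % 2 := by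
  obtain ⟨i, j, ⟨hij, hi, hj, hc, -⟩, rfl⟩ := h
  have a := pairs_eq _ _ h1.1
  have b := pairs_eq _ _ h2.1
  have c := height_add_pairs la
  have d := height_add_pairs (swapC la i j)
  have e := posSum_swap la i j hij hi hj
  have f := cnt_add_s1 la i j
  have g : (i : ℕ) < j := hij
  omega

theorem adj_parity {N : ℕ} (m n : ℕ) (la mu : Wt N) (h1 : IsWeight m n la) (h2 : IsWeight m n mu)
    (h : GammaAdj la mu) : height la % 2 ≠ height mu % 2 := by
  rcases h with h | h
  · exact step_parity m n la mu h1 h2 h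
  · exact (step_parity m n mu la h2 h1 h).symm

theorem walk_parity {N : ℕ} (m n : ℕ) (p : List (Wt N)) : ∀ (la mu : Wt N), (∀ v ∈ p, IsWeight m n v) →
      p.IsChain GammaAdj → p.head? = some la → p.getLast? = some mu →
      height la % 2 = (height mu + (p.length - 1)) % 2 := by
  induction p with
  | nil => intro la mu _ _ h; simp at h
  | cons a q ih =>
    intro la mu hw hc hh hl
    cases q with
    | nil =>
      simp at hh hl
      subst hh; subst hl; simp
    | cons b r =>
      simp only [List.head?_cons, Option.some.injEq] at hh
      subst hh
      rw [List.isChain_cons_cons] at hc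
      have h1 := adj_parity m n a b (hw a (by simp)) (hw b (by simp)) hc.1
      have h2 := ih b mu (fun v hv => hw v (List.mem_cons_of_mem _ hv)) hc.2 (by simp)
        (by simpa [List.getLast?_cons_cons] using hl)
      simp only [List.length_cons] at h2 ⊢
      omega

/-- `Γ_m^n` is bipartite w.r.t. the parity of the height: adjacent
weights have heights of opposite parity, and for every walk of length `ℓ` from `λ`
to `μ` one has `|λ| ≡ |μ| + ℓ (mod 2)`. -/
theorem statement1 (m n : ℕ) (hm : 1 ≤ m) (hn : 1 ≤ n) {N : ℕ} (hN : N = m + n) :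
    (∀ la mu : Wt N, IsWeight m n la → IsWeight m n mu → GammaAdj la mu →
      height la % 2 ≠ height mu % 2) ∧
    (∀ (p : List (Wt N)) (la mu : Wt N), p ≠ [] → (∀ v ∈ p, IsWeight m n v) →
      p.Chain' GammaAdj → p.head? = some la → p.getLast? = some mu →
      height la % 2 = (height mu + (p.length - 1)) % 2) := by
  exact ⟨adj_parity m n, fun p la mu _ hw hc hh hl => walk_parity m n p la mu hw hc hh hl⟩

end Kh
end

section
/- Let λ ≠ μ be weights of type (m,n) with |λ| ≤ |μ|. Then there is no weight ν adjacent in Γ_m^n to both λ and μ with |ν| = |λ| or |ν| = |μ|; equivalently, no path of length 2 in Γ_m^n between λ and μ passes through a vertex whose height equals |λ| or |μ|. -/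
open scoped Classical

namespace Kh

/-- The finset of inversions (an up to the left of a down). -/
noncomputable def invs {N : ℕ} (l : Wt N) : Finset (Fin N × Fin N) :=
  Finset.univ.filter fun p => p.1 < p.2 ∧ l p.1 = false ∧ l p.2 = true

theorem height_eq_card {N : ℕ} (l : Wt N) : height l = (invs l).card := by
  unfold height invs
  rw [Finset.card_filter, Fintype.sum_prod_type_right]
  refine Finset.sum_congr rfl fun i _ => ?_
  by_cases h : l i = true
  · rw [if_pos h, Set.ncard_eq_toFinset_card', ← Finset.card_filter]
    congr 1
    ext j
    simp [h]
  · simp [h]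

theorem height_lt_swapC {N : ℕ} (l : Wt N) (i j : Fin N) (hij : i < j)
    (hi : l i = true) (hj : l j = false) : height l < height (swapC l i j) := by
  rw [height_eq_card, height_eq_card]
  let e : Fin N × Fin N ↪ Fin N × Fin N :=
    ((Equiv.swap i j).prodCongr (Equiv.swap i j)).toEmbedding
  rw [← Finset.card_map e]
  apply Finset.card_lt_card
  rw [Finset.ssubset_iff_of_subset]
  · refine ⟨(i, j), ?_, ?_⟩
    · simp [invs, swapC, hi, hj, hij, hij.ne']
    · simp only [Finset.mem_map, not_exists, not_and]
      rintro ⟨a, b⟩ hab h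
      simp only [invs, Finset.mem_filter, Finset.mem_univ, true_and] at hab
      simp only [e, Equiv.coe_toEmbedding, Equiv.prodCongr_apply, Prod.map, Prod.mk.injEq] at h
      have ha : a = j := by
        rw [← Equiv.swap_apply_self i j a, h.1] <;> simp
      have hb : b = i := by
        rw [← Equiv.swap_apply_self i j b, h.2] <;> simp
      subst ha hb
      exact absurd hab.1 (not_lt.mpr hij.le)
  · intro p hp
    simp only [Finset.mem_map] at hp
    obtain ⟨⟨a, b⟩, hab, rfl⟩ := hp
    simp only [invs, Finset.mem_filter, Finset.mem_univ, true_and] at hab ⊢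
    simp only [e, Equiv.coe_toEmbedding, Equiv.prodCongr_apply, Prod.map, swapC,
      Equiv.swap_apply_def]
    grind

theorem height_ne_of_adj {N : ℕ} (l l' : Wt N) (h : GammaAdj l l') : height l ≠ height l' := by
  rcases h with ⟨i, j, ⟨hij, hi, hj, _⟩, rfl⟩ | ⟨i, j, ⟨hij, hi, hj, _⟩, rfl⟩
  · exact (height_lt_swapC _ i j hij hi hj).ne
  · exact (height_lt_swapC _ i j hij hi hj).ne'

/-- No length-2 path in `Γ_m^n` between distinct weights `λ`, `μ`
with `|λ| ≤ |μ|` passes through a vertex whose height equals `|λ|` or `|μ|`. -/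
theorem statement2 (m n : ℕ) (hm : 1 ≤ m) (hn : 1 ≤ n) {N : ℕ} (hN : N = m + n)
    (la mu : Wt N) (hla : IsWeight m n la) (hmu : IsWeight m n mu)
    (hne : la ≠ mu) (hle : height la ≤ height mu) :
    ∀ nu : Wt N, IsWeight m n nu → GammaAdj la nu → GammaAdj nu mu →
      height nu ≠ height la ∧ height nu ≠ height mu := by
  intro nu _ h1 h2
  exact ⟨(height_ne_of_adj _ _ h1).symm, height_ne_of_adj _ _ h2⟩

end Kh
end

section
/- In every 4-cycle of the graph Γ_m^n, the minimal height among the four vertices is attained at exactly one vertex, the maximal height is attained at exactly one vertex, and the two remaining vertices have heights strictly between the minimal and the maximal height. -/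
open scoped Classical

namespace Kh

/-- The value of a position as a sign. -/
def sg (b : Bool) : ℤ := if b = true then 1 else -1

/-- Prefix sums of signs. -/
noncomputable def pre {N : ℕ} (l : Wt N) (k : ℕ) : ℤ :=
  ∑ t : Fin N, if (t : ℕ) < k then sg (l t) else 0

lemma pre_succ {N : ℕ} (l : Wt N) (i : Fin N) : pre l (i + 1) = pre l i + sg (l i) := by
  unfold pre
  have : ∀ t : Fin N, (if (t : ℕ) < i + 1 then sg (l t) else 0)
      = (if (t : ℕ) < i then sg (l t) else 0) + (if t = i then sg (l t) else 0) := by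
    intro t
    rcases lt_trichotomy t i with h | h | h
    · have : (t : ℕ) < i := h
      simp [this, h.ne, Nat.lt_succ_of_lt this]
    · subst h; simp
    · have : (i : ℕ) < t := h
      have h1 : ¬ ((t : ℕ) < i + 1) := by omega
      have h2 : ¬ ((t : ℕ) < i) := by omega
      simp [h1, h2, h.ne']
  rw [Finset.sum_congr rfl (fun t _ => this t), Finset.sum_add_distrib]
  simp

lemma cnt_eq {N : ℕ} (l : Wt N) (b : Bool) (i j : Fin N) :
    (cnt l b i j : ℤ) = ∑ t : Fin N, if i < t ∧ t ≤ j ∧ l t = b then 1 else 0 := by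
  unfold cnt
  rw [Set.ncard_eq_toFinset_card']
  simp

lemma cnt_pre {N : ℕ} (l : Wt N) (i j : Fin N) (h : i ≤ j) :
    (cnt l true i j : ℤ) - cnt l false i j = pre l (j + 1) - pre l (i + 1) := by
  rw [cnt_eq, cnt_eq, ← Finset.sum_sub_distrib]
  unfold pre
  rw [← Finset.sum_sub_distrib]
  refine Finset.sum_congr rfl fun t _ => ?_
  have h1 : i < t ↔ (i : ℕ) < t := Iff.rfl
  have h2 : t ≤ j ↔ (t : ℕ) ≤ j := Iff.rfl
  have h3 : (i : ℕ) ≤ j := h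
  simp only [h1, h2]
  unfold sg
  cases l t <;> simp <;> split_ifs <;> omega

lemma circle_pre {N : ℕ} {l : Wt N} {i j : Fin N} (h : IsCircle l i j) :
    pre l (j + 1) = pre l (i + 1) - 1 ∧
    ∀ k : Fin N, i ≤ k → k < j → pre l (i + 1) ≤ pre l (k + 1) := by
  obtain ⟨h1, -, -, h4, h5⟩ := h
  constructor
  · have := cnt_pre l i j h1.le
    omega
  · intro k hk hkj
    rcases hk.eq_or_lt with rfl | hk
    · exact le_rfl
    · have := cnt_pre l i k hk.le
      have := h5 k hk hkj
      omega

lemma circle_aux {N : ℕ} {l : Wt N} {i j i' j' : Fin N} (h : IsCircle l i j)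
    (h' : IsCircle l i' j') :
    (i = i' → j' ≤ j) ∧ (j = j' → i' ≤ i) ∧ ¬ (i < i' ∧ i' < j ∧ j < j') := by
  obtain ⟨a1, a2⟩ := circle_pre h
  obtain ⟨b1, b2⟩ := circle_pre h'
  refine ⟨?_, ?_, ?_⟩
  · rintro rfl
    by_contra hc
    have := b2 j h.1.le (not_le.mp hc)
    omega
  · rintro rfl
    by_contra hc
    have hc : i < i' := not_le.mp hc
    have hc' : (i : ℕ) < i' := hc
    have hp : (i' : ℕ) - 1 + 1 = i' := by omega
    have h1 := h'.1
    have := a2 ⟨(i' : ℕ) - 1, by omega⟩ (by show (i : ℕ) ≤ i' - 1; omega)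
      (by have h2 : (i' : ℕ) < j := h1
          show (i' : ℕ) - 1 < j; omega)
    simp only [hp] at this
    have h3 := pre_succ l i'
    rw [h'.2.1] at h3
    simp [sg] at h3
    omega
  · rintro ⟨c1, c2, c3⟩
    have := a2 i' c1.le c2
    have := b2 j c2.le c3
    omega

lemma circle_pair {N : ℕ} {l : Wt N} {i j i' j' : Fin N} (h : IsCircle l i j)
    (h' : IsCircle l i' j') :
    (i = i' ∧ j = j') ∨ (i ≠ i' ∧ j ≠ j' ∧ i ≠ j' ∧ j ≠ i' ∧
      ¬ (i < i' ∧ i' < j ∧ j < j') ∧ ¬ (i' < i ∧ i < j' ∧ j' < j)) := by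
  obtain ⟨a1, a2, a3⟩ := circle_aux h h'
  obtain ⟨b1, b2, b3⟩ := circle_aux h' h
  have e1 : i ≠ j' := by
    rintro rfl; have := h.2.1; have := h'.2.2.1; simp_all
  have e2 : j ≠ i' := by
    rintro rfl; have := h'.2.1; have := h.2.2.1; simp_all
  have e3 : i = i' ↔ j = j' := by
    constructor
    · intro e; exact le_antisymm (b1 e.symm) (a1 e)
    · intro e; exact le_antisymm (b2 e.symm) (a2 e)
  by_cases hi : i = i'
  · exact Or.inl ⟨hi, e3.1 hi⟩
  · exact Or.inr ⟨hi, fun e => hi (e3.2 e), e1, e2, a3, b3⟩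

lemma noalt {N : ℕ} {l m a b : Wt N} (hla : GammaStep l a) (hlb : GammaStep l b)
    (hma : GammaStep m a) (hmb : GammaStep m b) (hlm : l ≠ m) (hab : a ≠ b) : False := by
  obtain ⟨i1, j1, c1, rfl⟩ := hla
  obtain ⟨i2, j2, c2, rfl⟩ := hlb
  obtain ⟨p1, q1, d1, e1⟩ := hma
  obtain ⟨p2, q2, d2, e2⟩ := hmb
  have hc := circle_pair c1 c2
  have hd := circle_pair d1 d2
  obtain ⟨c11, c12, c13, -⟩ := c1
  obtain ⟨c21, c22, c23, -⟩ := c2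
  obtain ⟨d11, d12, d13, -⟩ := d1
  obtain ⟨d21, d22, d23, -⟩ := d2
  rcases hc with ⟨rfl, rfl⟩ | ⟨x1, x2, x3, x4, x5, x6⟩
  · exact hab rfl
  rcases hd with ⟨rfl, rfl⟩ | ⟨y1, y2, y3, y4, y5, y6⟩
  · exact hab (e1.trans e2.symm)
  have E1 : ∀ t, swapC l i1 j1 t = swapC m p1 q1 t := fun t => congrFun e1 t
  have E2 : ∀ t, swapC l i2 j2 t = swapC m p2 q2 t := fun t => congrFun e2 t
  simp only [swapC, c12, c13, c22, c23, d12, d13, d22, d23] at E1 E2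
  have hpq : ¬ (p1 = i1 ∧ q1 = j1) := by
    rintro ⟨rfl, rfl⟩
    apply hlm
    funext t
    have := E1 t
    by_cases h1 : t = p1
    · rw [h1, c12, d12]
    · by_cases h2 : t = q1
      · rw [h2, c13, d13]
      · simpa [h1, h2] using this
  have f1 : i1 = p1 ∨ i1 = q2 := by
    have := E1 i1; have := E2 i1; grind
  have f2 : j2 = p1 ∨ j2 = q2 := by
    have := E1 j2; have := E2 j2; grind
  have f3 : j1 = q1 ∨ j1 = p2 := by
    have := E1 j1; have := E2 j1; grind
  have f4 : i2 = q1 ∨ i2 = p2 := by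
    have := E1 i2; have := E2 i2; grind
  clear E1 E2 e1 e2
  rcases f1 with rfl | rfl <;> rcases f2 with rfl | rfl <;> rcases f3 with rfl | rfl <;>
    rcases f4 with rfl | rfl <;> simp_all <;> omega

lemma height_eq {N : ℕ} (l : Wt N) :
    2 * (height l : ℤ) = 2 * (∑ i : Fin N, if l i = true then (i : ℤ) else 0)
      - (∑ i : Fin N, if l i = true then (1 : ℤ) else 0) ^ 2
      + (∑ i : Fin N, if l i = true then (1 : ℤ) else 0) := by
  have h0 : (height l : ℤ) = ∑ i : Fin N, ∑ j : Fin N,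
      if l i = true ∧ j < i ∧ l j = false then (1 : ℤ) else 0 := by
    unfold height
    push_cast
    refine Finset.sum_congr rfl fun i _ => ?_
    split_ifs with h
    · rw [Set.ncard_eq_toFinset_card']
      simp [h]
    · simp [h]
  have h1 : (∑ i : Fin N, if l i = true then (i : ℤ) else 0) = ∑ i : Fin N, ∑ j : Fin N,
      if l i = true ∧ j < i then (1 : ℤ) else 0 := by
    refine Finset.sum_congr rfl fun i _ => ?_
    by_cases h : l i = true
    · have : (Finset.univ.filter (fun j : Fin N => j < i)) = Finset.Iio i := by ext; simp
      simp only [h, true_and, if_true, Finset.sum_boole]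
      simp [this]
    · simp [h]
  have h2 : (∑ i : Fin N, if l i = true then (1 : ℤ) else 0) ^ 2 = ∑ i : Fin N, ∑ j : Fin N,
      if l i = true ∧ l j = true then (1 : ℤ) else 0 := by
    rw [sq, Finset.sum_mul_sum]
    refine Finset.sum_congr rfl fun i _ => Finset.sum_congr rfl fun j _ => ?_
    by_cases h : l i = true <;> by_cases h' : l j = true <;> simp [h, h']
  have h3 : (∑ i : Fin N, if l i = true then (1 : ℤ) else 0) = ∑ i : Fin N, ∑ j : Fin N,
      if l i = true ∧ j = i then (1 : ℤ) else 0 := by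
    refine Finset.sum_congr rfl fun i _ => ?_
    by_cases h : l i = true <;> simp [h]
  have h4 : (∑ i : Fin N, ∑ j : Fin N,
      if l i = true ∧ l j = true ∧ i < j then (1 : ℤ) else 0) = ∑ i : Fin N, ∑ j : Fin N,
      if l i = true ∧ l j = true ∧ j < i then (1 : ℤ) else 0 := by
    rw [Finset.sum_comm]
    refine Finset.sum_congr rfl fun i _ => Finset.sum_congr rfl fun j _ => ?_
    congr 1
    apply propext; tauto
  have h5 : (∑ i : Fin N, ∑ j : Fin N, if l i = true ∧ j < i ∧ l j = false then (1 : ℤ) else 0)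
      + (∑ i : Fin N, ∑ j : Fin N, if l i = true ∧ l j = true ∧ j < i then (1 : ℤ) else 0)
      = ∑ i : Fin N, ∑ j : Fin N, if l i = true ∧ j < i then (1 : ℤ) else 0 := by
    simp only [← Finset.sum_add_distrib]
    refine Finset.sum_congr rfl fun i _ => Finset.sum_congr rfl fun j _ => ?_
    by_cases h : l i = true <;> by_cases h' : l j = true <;> simp [h, h']
  have h6 : (∑ i : Fin N, ∑ j : Fin N,
      if l i = true ∧ l j = true ∧ i < j then (1 : ℤ) else 0) + (∑ i : Fin N, ∑ j : Fin N,
      if l i = true ∧ l j = true ∧ j < i then (1 : ℤ) else 0) + (∑ i : Fin N, ∑ j : Fin N,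
      if l i = true ∧ j = i then (1 : ℤ) else 0) = ∑ i : Fin N, ∑ j : Fin N,
      if l i = true ∧ l j = true then (1 : ℤ) else 0 := by
    simp only [← Finset.sum_add_distrib]
    refine Finset.sum_congr rfl fun i _ => Finset.sum_congr rfl fun j _ => ?_
    rcases lt_trichotomy i j with h | h | h
    · simp [h, h.ne', h.not_gt]
    · subst h; simp
    · simp [h, h.ne, h.not_gt]
  rw [h2, h0, h1, h3]
  linarith

lemma step_height {N m n : ℕ} {l l' : Wt N} (h : GammaStep l l') (hl : IsWeight m n l)
    (hl' : IsWeight m n l') : height l < height l' := by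
  have key : ∀ x : Wt N, IsWeight m n x →
      (∑ i : Fin N, if x i = true then (1 : ℤ) else 0) = m := by
    intro x hx
    rw [← hx.1, Set.ncard_eq_toFinset_card']
    simp
  have a1 := height_eq l
  have a2 := height_eq l'
  rw [key l hl] at a1
  rw [key l' hl'] at a2
  obtain ⟨i, j, c, rfl⟩ := h
  obtain ⟨c1, c2, c3, -⟩ := c
  have hs : (∑ t : Fin N, if swapC l i j t = true then (t : ℤ) else 0)
      = (∑ t : Fin N, if l t = true then (t : ℤ) else 0)
        + (∑ t : Fin N, if t = j then (t : ℤ) else 0) - ∑ t : Fin N, if t = i then (t : ℤ) else 0 := by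
    rw [← Finset.sum_add_distrib, ← Finset.sum_sub_distrib]
    refine Finset.sum_congr rfl fun t _ => ?_
    unfold swapC
    by_cases h1 : t = i
    · subst h1; simp [c2, c3, c1.ne]
    · by_cases h2 : t = j
      · subst h2; simp [c2, c3, h1]
      · simp [h1, h2]
  simp only [Finset.sum_ite_eq', Finset.mem_univ, if_true] at hs
  have : (i : ℕ) < j := c1
  omega

/-- In every 4-cycle of `Γ_m^n` the minimal height is attained at
exactly one vertex `a`, the maximal height at exactly one vertex `b`, and the two
remaining vertices have heights strictly between. -/
theorem statement5 (m n : ℕ) (hm : 1 ≤ m) (hn : 1 ≤ n) {N : ℕ} (hN : N = m + n)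
    (v : Fin 4 → Wt N) (hw : ∀ t, IsWeight m n (v t))
    (hdist : Function.Injective v)
    (hadj : ∀ t : Fin 4, GammaAdj (v t) (v (t + 1))) :
    ∃ a b : Fin 4, a ≠ b ∧
      (∀ t, t ≠ a → height (v a) < height (v t)) ∧
      (∀ t, t ≠ b → height (v t) < height (v b)) := by
  have H : ∀ s t, GammaStep (v s) (v t) → height (v s) < height (v t) :=
    fun s t h => step_height h (hw s) (hw t)
  have d02 : v 0 ≠ v 2 := fun h => absurd (hdist h) (by decide)
  have d13 : v 1 ≠ v 3 := fun h => absurd (hdist h) (by decide)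
  have h0 : GammaAdj (v 0) (v 1) := hadj 0
  have h1 : GammaAdj (v 1) (v 2) := hadj 1
  have h2 : GammaAdj (v 2) (v 3) := hadj 2
  have h3 : GammaAdj (v 3) (v 0) := hadj 3
  have fin : ∀ a b : Fin 4, a ≠ b →
      ((0 ≠ a → height (v a) < height (v 0)) ∧ (1 ≠ a → height (v a) < height (v 1)) ∧
       (2 ≠ a → height (v a) < height (v 2)) ∧ (3 ≠ a → height (v a) < height (v 3))) →
      ((0 ≠ b → height (v 0) < height (v b)) ∧ (1 ≠ b → height (v 1) < height (v b)) ∧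
       (2 ≠ b → height (v 2) < height (v b)) ∧ (3 ≠ b → height (v 3) < height (v b))) →
      ∃ a b : Fin 4, a ≠ b ∧
      (∀ t, t ≠ a → height (v a) < height (v t)) ∧
      (∀ t, t ≠ b → height (v t) < height (v b)) := by
    rintro a b hab ⟨x0, x1, x2, x3⟩ ⟨y0, y1, y2, y3⟩
    refine ⟨a, b, hab, ?_, ?_⟩
    · intro t; fin_cases t <;> assumption
    · intro t; fin_cases t <;> assumption
  rcases h0 with h0 | h0 <;> rcases h1 with h1 | h1 <;> rcases h2 with h2 | h2 <;>
    rcases h3 with h3 | h3 <;>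
  first
  | exact (noalt h0 h3 h1 h2 d02 d13).elim
  | exact (noalt h0 h1 h3 h2 d13 d02).elim
  | (have g0 := H _ _ h0
     have g1 := H _ _ h1
     have g2 := H _ _ h2
     have g3 := H _ _ h3
     first
     | omega
     | exact fin 0 1 (by decide) (by simp; omega) (by simp; omega)
     | exact fin 0 2 (by decide) (by simp; omega) (by simp; omega)
     | exact fin 0 3 (by decide) (by simp; omega) (by simp; omega)
     | exact fin 1 0 (by decide) (by simp; omega) (by simp; omega)
     | exact fin 1 2 (by decide) (by simp; omega) (by simp; omega)
     | exact fin 1 3 (by decide) (by simp; omega) (by simp; omega)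
     | exact fin 2 0 (by decide) (by simp; omega) (by simp; omega)
     | exact fin 2 1 (by decide) (by simp; omega) (by simp; omega)
     | exact fin 2 3 (by decide) (by simp; omega) (by simp; omega)
     | exact fin 3 0 (by decide) (by simp; omega) (by simp; omega)
     | exact fin 3 1 (by decide) (by simp; omega) (by simp; omega)
     | exact fin 3 2 (by decide) (by simp; omega) (by simp; omega))

end Kh
end

section
/- For any two distinct weights λ and μ of type (m,n), there are at most three paths of length 2 between λ and μ in the graph Γ_m^n; equivalently, at most three weights of type (m,n) are adjacent in Γ_m^n to both λ and μ. -/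
open scoped Classical

namespace Kh


/-- Height function of the bracket word. -/
def HH {N : ℕ} (l : Wt N) (k : ℕ) : ℤ :=
  ∑ t : Fin N, if t.val < k then (if l t = true then 1 else -1) else 0

theorem HH_succ {N : ℕ} (l : Wt N) (z : Fin N) :
    HH l (z.val + 1) = HH l z.val + (if l z = true then 1 else -1) := by
  unfold HH
  have h : ∀ t : Fin N, (if t.val < z.val + 1 then (if l t = true then (1:ℤ) else -1) else 0)
      = (if t.val < z.val then (if l t = true then (1:ℤ) else -1) else 0)
        + (if t = z then (if l z = true then (1:ℤ) else -1) else 0) := by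
    intro t
    by_cases h1 : t = z
    · subst h1; simp
    · have h2 : t.val ≠ z.val := fun h => h1 (Fin.ext h)
      have h3 : t.val < z.val + 1 ↔ t.val < z.val := by omega
      simp [h1, h3]
  rw [Finset.sum_congr rfl (fun t _ => h t), Finset.sum_add_distrib]
  simp

/-- The segment strictly between `a` and `b` is a balanced bracket word. -/
def DD {N : ℕ} (l : Wt N) (a b : Fin N) : Prop :=
  HH l b.val = HH l (a.val + 1) ∧
    ∀ k : Fin N, a < k → k < b → HH l (a.val + 1) ≤ HH l (k.val + 1)

theorem HH_congr {N : ℕ} {l l' : Wt N} {a b : Fin N}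
    (h : ∀ t, a < t → t < b → l t = l' t) (k : ℕ) (h1 : a.val + 1 ≤ k) (h2 : k ≤ b.val) :
    HH l k - HH l (a.val + 1) = HH l' k - HH l' (a.val + 1) := by
  induction k, h1 using Nat.le_induction with
  | base => simp
  | succ k hk ih =>
    have hkN : k < N := by omega
    have e1 := HH_succ l ⟨k, hkN⟩
    have e2 := HH_succ l' ⟨k, hkN⟩
    have e3 := h ⟨k, hkN⟩ (by rw [Fin.lt_def]; simp; omega) (by rw [Fin.lt_def]; simp; omega)
    have := ih (by omega)
    simp only at e1 e2
    rw [e3] at e1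
    linarith

theorem DD_congr {N : ℕ} {l l' : Wt N} {a b : Fin N} (hab : a < b)
    (h : ∀ t, a < t → t < b → l t = l' t) (hD : DD l a b) : DD l' a b := by
  have hab' : a.val < b.val := hab
  refine ⟨?_, fun k hk1 hk2 => ?_⟩
  · have := HH_congr h b.val hab' le_rfl
    have := hD.1
    linarith
  · have hk1' : a.val < k.val := hk1
    have hk2' : k.val < b.val := hk2
    have := HH_congr h (k.val + 1) (by omega) (by omega)
    have := hD.2 k hk1 hk2
    linarith

theorem F1 {N : ℕ} {l : Wt N} {a z q : Fin N} (h1 : DD l a z) (h2 : DD l a q)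
    (haz : a < z) (hzq : z < q) : l z = true := by
  have e := HH_succ l z
  have := h1.1
  have := h2.2 z haz hzq
  by_contra hc
  rw [if_neg hc] at e
  linarith

theorem F1' {N : ℕ} {l : Wt N} {p z q : Fin N} (h1 : DD l z q) (h2 : DD l p q)
    (hpz : p < z) (hzq : z < q) : l z = false := by
  have e := HH_succ l z
  have e1 := h1.1
  have e2 := h2.1
  have hpz' : p.val < z.val := hpz
  have key : HH l (p.val + 1) ≤ HH l z.val := by
    by_cases hh : p.val + 1 = z.val
    · rw [hh]
    · have hzN := z.isLt
      have := h2.2 ⟨z.val - 1, by omega⟩ (by rw [Fin.lt_def]; simp; omega)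
        (by rw [Fin.lt_def]; have : z.val < q.val := hzq; simp; omega)
      simp only at this
      rwa [Nat.sub_add_cancel (by omega)] at this
  by_contra hc
  rw [if_pos (by simpa using hc)] at e
  linarith

theorem F2 {N : ℕ} {l : Wt N} {p q z w : Fin N} (h1 : DD l p z) (h2 : DD l z q)
    (h3 : DD l p w) (h4 : DD l w q) : l z = l w := by
  have e1 := HH_succ l z
  have e2 := HH_succ l w
  have := h1.1
  have := h2.1
  have := h3.1
  have := h4.1
  cases hz : l z <;> cases hw : l w <;> simp_all <;> linarith

theorem cnt_HH {N : ℕ} (l : Wt N) (i k : Fin N) (hik : i ≤ k) :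
    (cnt l true i k : ℤ) - cnt l false i k = HH l (k.val + 1) - HH l (i.val + 1) := by
  unfold cnt HH
  rw [Set.ncard_eq_toFinset_card', Set.ncard_eq_toFinset_card']
  simp only [Set.toFinset_ofPred, Finset.card_filter]
  push_cast
  rw [← Finset.sum_sub_distrib, ← Finset.sum_sub_distrib]
  apply Finset.sum_congr rfl
  intro t _
  have hik' : i.val ≤ k.val := hik
  simp only [Fin.lt_def, Fin.le_def]
  cases l t <;> simp <;> split_ifs <;> omega

theorem circle_DD {N : ℕ} {l : Wt N} {i j : Fin N} (h : IsCircle l i j) : DD l i j := by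
  obtain ⟨hij, hi, hj, h1, h2⟩ := h
  refine ⟨?_, fun k hk1 hk2 => ?_⟩
  · have := cnt_HH l i j hij.le
    have e := HH_succ l j
    simp only [hj] at e
    simp at e
    push_cast [← h1] at this
    linarith
  · have := cnt_HH l i k hk1.le
    have h3 : (cnt l false i k : ℤ) ≤ cnt l true i k := by exact_mod_cast h2 k hk1 hk2
    linarith

/-- Flip the values at two positions. -/
def flip2 {N : ℕ} (l : Wt N) (x y : Fin N) : Wt N :=
  fun t => if t = x ∨ t = y then !l t else l t

/-- Symmetric form of adjacency. -/
def Adj' {N : ℕ} (l l' : Wt N) (a b : Fin N) : Prop :=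
  a < b ∧ l a ≠ l b ∧ l' = flip2 l a b ∧ DD l a b

theorem flip2_flip2 {N : ℕ} (l : Wt N) (x y : Fin N) : flip2 (flip2 l x y) x y = l := by
  funext t; unfold flip2; split_ifs <;> simp

theorem Adj'_symm {N : ℕ} {l l' : Wt N} {a b : Fin N} (h : Adj' l l' a b) : Adj' l' l a b := by
  obtain ⟨h1, h2, rfl, h4⟩ := h
  refine ⟨h1, ?_, (flip2_flip2 _ _ _).symm, DD_congr h1 ?_ h4⟩
  · simp [flip2, h2]
  · intro t ht1 ht2
    simp [flip2, ht1.ne', ht2.ne]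

theorem step_adj {N : ℕ} {l l' : Wt N} (h : GammaStep l l') : ∃ a b, Adj' l l' a b := by
  obtain ⟨i, j, hc, rfl⟩ := h
  have hD := circle_DD hc
  obtain ⟨hij, hi, hj, -, -⟩ := hc
  refine ⟨i, j, hij, by simp [hi, hj], ?_, hD⟩
  funext t
  unfold swapC flip2
  grind

theorem adj_adj {N : ℕ} {l l' : Wt N} (h : GammaAdj l l') : ∃ a b, Adj' l l' a b := by
  rcases h with h | h
  · exact step_adj h
  · obtain ⟨a, b, h⟩ := step_adj h
    exact ⟨a, b, Adj'_symm h⟩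

theorem ncard_three {α : Type*} {S A B C : Set α} (h : S ⊆ A ∪ B ∪ C)
    (hA : A.Subsingleton) (hB : B.Subsingleton) (hC : C.Subsingleton) : S.ncard ≤ 3 := by
  have h1 := (Set.ncard_le_one hA.finite).2 (fun _ x _ y => hA x y)
  have h2 := (Set.ncard_le_one hB.finite).2 (fun _ x _ y => hB x y)
  have h3 := (Set.ncard_le_one hC.finite).2 (fun _ x _ y => hC x y)
  have h4 := Set.ncard_le_ncard h ((hA.finite.union hB.finite).union hC.finite)
  have h5 := Set.ncard_union_le (A ∪ B) C
  have h6 := Set.ncard_union_le A B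
  omega

/-- Common neighbours in symmetric form. -/
def CN {N : ℕ} (la mu : Wt N) : Set (Wt N) :=
  {nu | (∃ a b, Adj' la nu a b) ∧ (∃ c d, Adj' nu mu c d)}

def SA {N : ℕ} (l : Wt N) (p q : Fin N) : Set (Wt N) :=
  {nu | ∃ z, q < z ∧ l z = false ∧ DD l q z ∧ nu = flip2 l p z}
def SB {N : ℕ} (l : Wt N) (p q : Fin N) : Set (Wt N) :=
  {nu | ∃ z, z < p ∧ l z = true ∧ DD l z p ∧ nu = flip2 l q z}
def SC {N : ℕ} (l : Wt N) (p q : Fin N) : Set (Wt N) :=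
  {nu | ∃ z, p < z ∧ z < q ∧ l z = false ∧ DD l p z ∧ DD l z q ∧ nu = flip2 l p z}
def SD {N : ℕ} (l : Wt N) (p q : Fin N) : Set (Wt N) :=
  {nu | ∃ z, p < z ∧ z < q ∧ l z = true ∧ DD l p z ∧ DD l z q ∧ nu = flip2 l q z}

theorem SA_sub {N : ℕ} (l : Wt N) (p q : Fin N) : (SA l p q).Subsingleton := by
  rintro _ ⟨z, h1, h2, h3, rfl⟩ _ ⟨w, g1, g2, g3, rfl⟩
  rcases lt_trichotomy z w with h | h | h
  · have := F1 h3 g3 h1 h; simp_all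
  · rw [h]
  · have := F1 g3 h3 g1 h; simp_all

theorem SB_sub {N : ℕ} (l : Wt N) (p q : Fin N) : (SB l p q).Subsingleton := by
  rintro _ ⟨z, h1, h2, h3, rfl⟩ _ ⟨w, g1, g2, g3, rfl⟩
  rcases lt_trichotomy z w with h | h | h
  · have := F1' g3 h3 h g1; simp_all
  · rw [h]
  · have := F1' h3 g3 h h1; simp_all

theorem SCD_sub {N : ℕ} (l : Wt N) (p q : Fin N) : (SC l p q ∪ SD l p q).Subsingleton := by
  rintro _ (⟨z, h0, h1, h2, h3, h4, rfl⟩ | ⟨z, h0, h1, h2, h3, h4, rfl⟩) _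
    (⟨w, g0, g1, g2, g3, g4, rfl⟩ | ⟨w, g0, g1, g2, g3, g4, rfl⟩)
  · rcases lt_trichotomy z w with h | h | h
    · have := F1 h3 g3 h0 h; simp_all
    · rw [h]
    · have := F1 g3 h3 g0 h; simp_all
  · have := F2 h3 h4 g3 g4; simp_all
  · have := F2 h3 h4 g3 g4; simp_all
  · rcases lt_trichotomy z w with h | h | h
    · have := F1' g4 h4 h g1; simp_all
    · rw [h]
    · have := F1' h4 g4 h h1; simp_all

theorem flip2_eq {N : ℕ} {l : Wt N} {a b c d : Fin N} (hab : a < b) (hcd : c < d)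
    (h : flip2 l a b = flip2 l c d) : a = c ∧ b = d := by
  have ha := congrFun h a
  have hb := congrFun h b
  unfold flip2 at ha hb
  grind

/-- Symmetric adjacency at an unordered pair. -/
theorem flip2_comm {N : ℕ} (l : Wt N) (a b : Fin N) : flip2 l a b = flip2 l b a := by
  unfold flip2; funext t; simp [or_comm]

/-- Unordered adjacency. -/
def UAdj {N : ℕ} (l l' : Wt N) (a b : Fin N) : Prop :=
  l a ≠ l b ∧ l' = flip2 l a b ∧ (a < b → DD l a b) ∧ (b < a → DD l b a)

theorem Adj'.u {N : ℕ} {l l' : Wt N} {a b : Fin N} (h : Adj' l l' a b) : UAdj l l' a b :=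
  ⟨h.2.1, h.2.2.1, fun _ => h.2.2.2, fun g => absurd h.1 g.asymm⟩

theorem UAdj.swap {N : ℕ} {l l' : Wt N} {a b : Fin N} (h : UAdj l l' a b) : UAdj l l' b a :=
  ⟨h.1.symm, by rw [flip2_comm]; exact h.2.1, h.2.2.2, h.2.2.1⟩

/-- Shape of common neighbours when the two weights differ in exactly two places. -/
theorem shape2 {N : ℕ} {la mu nu : Wt N} {p q : Fin N} (hpq : p ≠ q)
    (hmu : mu = flip2 la p q) (h : nu ∈ CN la mu) :
    ∃ z, z ≠ p ∧ z ≠ q ∧ ((UAdj la nu p z ∧ UAdj nu mu z q) ∨ (UAdj la nu q z ∧ UAdj nu mu z p)) := by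
  obtain ⟨⟨a, b, h1⟩, ⟨c, d, h2⟩⟩ := h
  have u1 := h1.u
  have u2 := h2.u
  have key : ∀ t, (t = p ∨ t = q) ↔ ¬ ((t = a ∨ t = b) ↔ (t = c ∨ t = d)) := by
    intro t
    have e1 := congrFun hmu t
    have e2 := congrFun h1.2.2.1 t
    have e3 := congrFun h2.2.2.1 t
    unfold flip2 at e1 e2 e3
    rw [e1, e2] at e3
    clear hmu u1 u2 h1 h2; cases hla : la t <;> rw [hla] at e3 <;> grind
  have hab := h1.1.ne
  have hcd := h2.1.ne
  have kp := key p
  have kq := key q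
  have ka := key a
  have kb := key b
  have kc := key c
  have kd := key d
  have v1 := u1.swap
  have v2 := u2.swap
  clear h1 h2 key hmu
  by_cases c1 : a = c
  · subst c1
    have : (b = p ∧ d = q) ∨ (b = q ∧ d = p) := by grind
    rcases this with ⟨rfl, rfl⟩ | ⟨rfl, rfl⟩
    · exact ⟨a, by grind, by grind, Or.inl ⟨v1, u2⟩⟩
    · exact ⟨a, by grind, by grind, Or.inr ⟨v1, u2⟩⟩
  by_cases c2 : a = d
  · subst c2
    have : (b = p ∧ c = q) ∨ (b = q ∧ c = p) := by grind
    rcases this with ⟨rfl, rfl⟩ | ⟨rfl, rfl⟩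
    · exact ⟨a, by grind, by grind, Or.inl ⟨v1, v2⟩⟩
    · exact ⟨a, by grind, by grind, Or.inr ⟨v1, v2⟩⟩
  by_cases c3 : b = c
  · subst c3
    have : (a = p ∧ d = q) ∨ (a = q ∧ d = p) := by grind
    rcases this with ⟨rfl, rfl⟩ | ⟨rfl, rfl⟩
    · exact ⟨b, by grind, by grind, Or.inl ⟨u1, u2⟩⟩
    · exact ⟨b, by grind, by grind, Or.inr ⟨u1, u2⟩⟩
  by_cases c4 : b = d
  · subst c4
    have : (a = p ∧ c = q) ∨ (a = q ∧ c = p) := by grind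
    rcases this with ⟨rfl, rfl⟩ | ⟨rfl, rfl⟩
    · exact ⟨b, by grind, by grind, Or.inl ⟨u1, v2⟩⟩
    · exact ⟨b, by grind, by grind, Or.inr ⟨u1, v2⟩⟩
  · exfalso
    grind

theorem case2 {N : ℕ} {la mu : Wt N} {p q : Fin N} (hpq : p < q) (hp : la p = true)
    (hq : la q = false) (hmu : mu = flip2 la p q) : (CN la mu).ncard ≤ 3 := by
  apply ncard_three (A := SA la p q) (B := SB la p q) (C := SC la p q ∪ SD la p q) ?_
    (SA_sub _ _ _) (SB_sub _ _ _) (SCD_sub _ _ _)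
  intro nu hnu
  obtain ⟨z, hzp, hzq, ⟨⟨h1, h2, h3, h4⟩, ⟨g1, g2, g3, g4⟩⟩ | ⟨⟨h1, h2, h3, h4⟩, ⟨g1, g2, g3, g4⟩⟩⟩ :=
    shape2 hpq.ne hmu hnu
  · have hz : la z = false := by
      rw [hp] at h1; simpa using h1.symm
    rcases lt_or_gt_of_ne hzp with hzp' | hzp'
    · exfalso
      have hzq' := hzp'.trans hpq
      have d1 : DD nu z p := DD_congr hzp' (by
        intro t t1 t2; rw [h2]; simp [flip2, t1.ne', t2.ne]) (h4 hzp')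
      have := F1 d1 (g3 hzq') hzp' hpq
      rw [h2] at this
      simp [flip2, hp] at this
    · rcases lt_or_gt_of_ne hzq with hzq' | hzq'
      · refine Or.inr (Or.inl ⟨z, hzp', hzq', hz, h3 hzp', DD_congr hzq' ?_ (g3 hzq'), h2⟩)
        intro t t1 t2
        rw [h2]; simp [flip2, t1.ne', (hzp'.trans t1).ne']
      · refine Or.inl (Or.inl ⟨z, hzq', hz, DD_congr hzq' ?_ (g4 hzq'), h2⟩)
        intro t t1 t2
        rw [h2]; simp [flip2, t2.ne, (hpq.trans t1).ne']
  · have hz : la z = true := by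
      rw [hq] at h1; simpa using h1.symm
    rcases lt_or_gt_of_ne hzp with hzp' | hzp'
    · refine Or.inl (Or.inr ⟨z, hzp', hz, DD_congr hzp' ?_ (g3 hzp'), h2⟩)
      intro t t1 t2
      rw [h2]; simp [flip2, t1.ne', (t2.trans hpq).ne]
    · rcases lt_or_gt_of_ne hzq with hzq' | hzq'
      · refine Or.inr (Or.inr ⟨z, hzp', hzq', hz, DD_congr hzp' ?_ (g4 hzp'), h4 hzq', h2⟩)
        intro t t1 t2
        rw [h2]; simp [flip2, t2.ne, (t2.trans hzq').ne]
      · exfalso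
        have d1 : DD nu q z := DD_congr hzq' (by
          intro t t1 t2; rw [h2]; simp [flip2, t1.ne', t2.ne]) (h3 hzq')
        have := F1' d1 (g4 hzp') hpq hzq'
        rw [h2] at this
        simp [flip2, hq] at this

theorem CN_symm {N : ℕ} (la mu : Wt N) : CN la mu = CN mu la := by
  ext nu
  constructor
  · rintro ⟨⟨a, b, h1⟩, ⟨c, d, h2⟩⟩
    exact ⟨⟨c, d, Adj'_symm h2⟩, ⟨a, b, Adj'_symm h1⟩⟩
  · rintro ⟨⟨a, b, h1⟩, ⟨c, d, h2⟩⟩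
    exact ⟨⟨c, d, Adj'_symm h2⟩, ⟨a, b, Adj'_symm h1⟩⟩

theorem case2' {N : ℕ} {la mu : Wt N} {p q : Fin N} (hpq : la p ≠ la q)
    (hmu : mu = flip2 la p q) : (CN la mu).ncard ≤ 3 := by
  wlog h : p < q generalizing p q
  · have hpq2 : p ≠ q := fun h => hpq (by rw [h])
    exact this (p := q) (q := p) hpq.symm (by rw [hmu, flip2_comm]) (by
      exact lt_of_le_of_ne (not_lt.1 h) hpq2.symm)
  cases hp : la p
  · rw [CN_symm]
    refine case2 (p := p) (q := q) h ?_ ?_ ?_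
    · rw [hmu]; simp [flip2, hp]
    · rw [hmu]; rw [hp] at hpq; simp [flip2]; simpa using hpq.symm
    · rw [hmu, flip2_flip2]
  · refine case2 h hp ?_ hmu
    rw [hp] at hpq; simpa using hpq.symm

/-- Four differences, `p1` the leftmost one. -/
theorem case4aux {N : ℕ} {la mu : Wt N} {p1 p2 q1 q2 : Fin N} (hq : q1 < q2) (h1 : p1 < q1)
    (hp : p1 < p2) (hlp1 : la p1 = true) (hlp2 : la p2 = true) (hlq1 : la q1 = false)
    (hlq2 : la q2 = false) (hmu : mu = flip2 (flip2 la p1 p2) q1 q2) :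
    (CN la mu).ncard ≤ 3 := by
  have h2 := h1.trans hq
  have hsub : CN la mu ⊆ {flip2 la p1 q1, flip2 la p1 q2, flip2 la p2 q1, flip2 la p2 q2} := by
    rintro nu ⟨⟨a, b, ha⟩, ⟨c, d, hc⟩⟩
    obtain ⟨-, hab', e1, -⟩ := ha
    obtain ⟨-, -, e2, -⟩ := hc
    have key : ∀ t, (t = p1 ∨ t = p2 ∨ t = q1 ∨ t = q2) → ((t = a ∨ t = b) ∨ (t = c ∨ t = d)) := by
      intro t
      have e1 := congrFun e1 t
      have e2 := congrFun e2 t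
      have e3 := congrFun hmu t
      unfold flip2 at e1 e2 e3
      rw [e1, e3] at e2
      grind
    have k1 := key p1
    have k2 := key p2
    have k3 := key q1
    have k4 := key q2
    have : (a = p1 ∨ a = p2 ∨ a = q1 ∨ a = q2) ∧ (b = p1 ∨ b = p2 ∨ b = q1 ∨ b = q2) := by grind
    rw [e1]
    have c1 := flip2_comm la
    rcases this with ⟨rfl | rfl | rfl | rfl, rfl | rfl | rfl | rfl⟩ <;> simp_all
  have hD : ∀ x, p1 < x → flip2 la p1 x ∈ CN la mu → DD la p1 x := by
    rintro x hx ⟨⟨a, b, ha⟩, -⟩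
    obtain ⟨rfl, rfl⟩ := flip2_eq hx ha.1 ha.2.2.1
    exact ha.2.2.2
  by_cases hc : flip2 la p1 q1 ∈ CN la mu
  · have hc' : flip2 la p1 q2 ∉ CN la mu := by
      intro hc'
      have := F1 (hD _ h1 hc) (hD _ h2 hc') h1 hq
      simp_all
    apply ncard_three (A := {flip2 la p1 q1}) (B := {flip2 la p2 q1}) (C := {flip2 la p2 q2}) ?_
      (by simp) (by simp) (by simp)
    intro nu hnu
    have := hsub hnu
    simp only [Set.mem_insert_iff, Set.mem_singleton_iff, Set.mem_union] at this ⊢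
    rcases this with h | h | h | h <;> subst h <;> simp_all
  · apply ncard_three (A := {flip2 la p1 q2}) (B := {flip2 la p2 q1}) (C := {flip2 la p2 q2}) ?_
      (by simp) (by simp) (by simp)
    intro nu hnu
    have := hsub hnu
    simp only [Set.mem_insert_iff, Set.mem_singleton_iff, Set.mem_union] at this ⊢
    rcases this with h | h | h | h <;> subst h <;> simp_all

theorem case4 {N : ℕ} {la mu : Wt N} {p1 p2 q1 q2 : Fin N} (hq : q1 < q2) 
    (hp : p1 < p2) (hlp1 : la p1 = true) (hlp2 : la p2 = true) (hlq1 : la q1 = false)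
    (hlq2 : la q2 = false) (hmu : mu = flip2 (flip2 la p1 p2) q1 q2) :
    (CN la mu).ncard ≤ 3 := by
  rcases lt_trichotomy p1 q1 with h | h | h
  · exact case4aux hq h hp hlp1 hlp2 hlq1 hlq2 hmu
  · simp_all
  · rw [CN_symm]
    have n1 : p1 ≠ q1 := by rintro rfl; simp_all
    have n2 : p1 ≠ q2 := by rintro rfl; simp_all
    have n3 : p2 ≠ q1 := by rintro rfl; simp_all
    have n4 : p2 ≠ q2 := by rintro rfl; simp_all
    refine case4aux (p1 := q1) (p2 := q2) (q1 := p1) (q2 := p2) hp h hq ?_ ?_ ?_ ?_ ?_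
    · rw [hmu]; simp [flip2, hlq1, n1.symm, n3.symm]
    · rw [hmu]; simp [flip2, hlq2, n2.symm, n4.symm]
    · rw [hmu]; simp [flip2, hlp1, n1, n2]
    · rw [hmu]; simp [flip2, hlp2, n3, n4]
    · rw [hmu, flip2_flip2, flip2_flip2]

theorem case4' {N : ℕ} {la mu : Wt N} {p1 p2 q1 q2 : Fin N} (hq : q1 ≠ q2) 
    (hp : p1 ≠ p2) (hlp1 : la p1 = true) (hlp2 : la p2 = true) (hlq1 : la q1 = false)
    (hlq2 : la q2 = false) (hmu : mu = flip2 (flip2 la p1 p2) q1 q2) :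
    (CN la mu).ncard ≤ 3 := by
  rcases lt_or_gt_of_ne hq with h | h <;> rcases lt_or_gt_of_ne hp with g | g
  · exact case4 h g hlp1 hlp2 hlq1 hlq2 hmu
  · exact case4 h g hlp2 hlp1 hlq1 hlq2 (by rw [hmu, flip2_comm la])
  · exact case4 h g hlp1 hlp2 hlq2 hlq1 (by rw [hmu, flip2_comm _ q1])
  · exact case4 h g hlp2 hlp1 hlq2 hlq1 (by rw [hmu, flip2_comm la, flip2_comm _ q1])

theorem CN_card {N : ℕ} {la mu : Wt N} (hne : la ≠ mu) : (CN la mu).ncard ≤ 3 := by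
  rcases Set.eq_empty_or_nonempty (CN la mu) with h | ⟨nu, ⟨a, b, h1⟩, ⟨c, d, h2⟩⟩
  · simp [h]
  obtain ⟨hab, n1, rfl, -⟩ := h1
  obtain ⟨hcd, n2, hmu, -⟩ := h2
  have hab := hab.ne
  have hcd := hcd.ne
  by_cases c1 : a = c
  · subst c1
    by_cases c2 : b = d
    · subst c2
      rw [flip2_flip2] at hmu
      exact absurd hmu.symm hne
    · refine case2' (p := b) (q := d) ?_ ?_
      · unfold flip2 at n2; grind
      · rw [hmu]; funext t; unfold flip2; cases hlt : la t <;> grind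
  by_cases c2 : a = d
  · subst c2
    by_cases c2 : b = c
    · subst c2
      rw [flip2_comm _ b, flip2_flip2] at hmu
      exact absurd hmu.symm hne
    · refine case2' (p := b) (q := c) ?_ ?_
      · unfold flip2 at n2; grind
      · rw [hmu]; funext t; unfold flip2; cases hlt : la t <;> grind
  by_cases c3 : b = c
  · subst c3
    refine case2' (p := a) (q := d) ?_ ?_
    · unfold flip2 at n2; grind
    · rw [hmu]; funext t; unfold flip2; cases hlt : la t <;> grind
  by_cases c4 : b = d
  · subst c4
    refine case2' (p := a) (q := c) ?_ ?_
    · unfold flip2 at n2; grind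
    · rw [hmu]; funext t; unfold flip2; cases hlt : la t <;> grind
  have n3 : la c ≠ la d := by unfold flip2 at n2; grind
  have f : ∀ w x y z : Fin N, (∀ t, (t = w ∨ t = x ∨ t = y ∨ t = z) ↔
      (t = a ∨ t = b ∨ t = c ∨ t = d)) → w ≠ y → w ≠ z → x ≠ y → x ≠ z →
      mu = flip2 (flip2 la w x) y z := by
    intro w x y z ht _ _ _ _
    rw [hmu]; funext t
    have := ht t
    unfold flip2; cases hlt : la t <;> grind
  cases ha : la a <;> cases hc : la c
  · exact case4' (p1 := b) (p2 := d) (q1 := a) (q2 := c) c1 c4 (by grind) (by grind) ha hc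
      (f _ _ _ _ (by grind) (by grind) (by grind) (by grind) (by grind))
  · exact case4' (p1 := b) (p2 := c) (q1 := a) (q2 := d) c2 c3 (by grind) (by grind) ha (by grind)
      (f _ _ _ _ (by grind) (by grind) (by grind) (by grind) (by grind))
  · exact case4' (p1 := a) (p2 := d) (q1 := b) (q2 := c) c3 c2 (by grind) (by grind) (by grind) hc
      (f _ _ _ _ (by grind) (by grind) (by grind) (by grind) (by grind))
  · exact case4' (p1 := a) (p2 := c) (q1 := b) (q2 := d) c4 c1 (by grind) (by grind) (by grind)
      (by grind) (f _ _ _ _ (by grind) (by grind) (by grind) (by grind) (by grind))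

/-- Between any two distinct weights there are at most three
length-2 paths in `Γ_m^n`, i.e. at most three weights adjacent to both. -/
theorem statement7 (m n : ℕ) (hm : 1 ≤ m) (hn : 1 ≤ n) {N : ℕ} (hN : N = m + n)
    (la mu : Wt N) (hla : IsWeight m n la) (hmu : IsWeight m n mu) (hne : la ≠ mu) :
    {nu : Wt N | IsWeight m n nu ∧ GammaAdj la nu ∧ GammaAdj nu mu}.ncard ≤ 3 := by
  refine le_trans (Set.ncard_le_ncard ?_ (Set.toFinite _)) (CN_card hne)
  rintro nu ⟨-, h1, h2⟩
  exact ⟨adj_adj h1, adj_adj h2⟩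

end Kh
end
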